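/- Let x* ∈ ℝ^n be k-sparse, b = Ax*, and suppose A satisfies the RIP of order 2k with constant δ_{2k}. Let 1/2 < η < 1 satisfy δ_{2k} < 1 − 1/(2η). Let x be a least-squares solution on a support I with |I| = k, and suppose f(x) > 0. Set z = x − η Aᵀ(Ax − b). Let 1 ≤ l ≤ k, let L ⊆ Iᶜ with |L| = l satisfy |z_j| ≥ |z_{j'}| for all j ∈ L, j' ∈ Iᶜ\L, and let S ⊆ I ∪ L with |S| = k satisfy |z_j| ≥ |z_{j'}| for all j ∈ S, j' ∈ (I ∪ L)\S (the partial hard thresholding step). Define y = z_S and the found set F = S\I. Then F ≠ ∅ and ‖y_F‖² ≥ (l/k) · c · f(x), where c = min(4η(1−η)², 2(2η − 1/(1−δ_{2k}))) > 0. -/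

import Mathlib

open Finset Matrix

noncomputable def nrm {d : ℕ} (x : Fin d → ℝ) : ℝ := Real.sqrt (∑ i, (x i)^2)

noncomputable def supp {d : ℕ} (x : Fin d → ℝ) : Finset (Fin d) := Finset.univ.filter (fun i => x i ≠ 0)

def restr {d : ℕ} (x : Fin d → ℝ) (I : Finset (Fin d)) : Fin d → ℝ := fun i => if i ∈ I then x i else 0

noncomputable def dotp {d : ℕ} (x y : Fin d → ℝ) : ℝ := ∑ i, x i * y i

def RIP {m n : ℕ} (A : Matrix (Fin m) (Fin n) ℝ) (s : ℕ) (δ : ℝ) : Prop :=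
  0 ≤ δ ∧ δ < 1 ∧ ∀ x : Fin n → ℝ, (supp x).card ≤ s →
    (1 - δ) * (nrm x)^2 ≤ (nrm (A.mulVec x))^2 ∧ (nrm (A.mulVec x))^2 ≤ (1 + δ) * (nrm x)^2

def lsSol {m n : ℕ} (A : Matrix (Fin m) (Fin n) ℝ) (b : Fin m → ℝ) (I : Finset (Fin n)) (x : Fin n → ℝ) : Prop :=
  supp x ⊆ I ∧ ∀ i ∈ I, Aᵀ.mulVec (A.mulVec x - b) i = 0

noncomputable def obj {m n : ℕ} (A : Matrix (Fin m) (Fin n) ℝ) (b : Fin m → ℝ) (x : Fin n → ℝ) : ℝ :=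
  (1/2) * (nrm (A.mulVec x - b))^2

theorem nrm_sq {d : ℕ} (x : Fin d → ℝ) : nrm x ^ 2 = ∑ i, x i ^ 2 :=
  Real.sq_sqrt (Finset.sum_nonneg fun _ _ => sq_nonneg _)

theorem nrm_restr_sq {d : ℕ} (x : Fin d → ℝ) (I : Finset (Fin d)) :
    nrm (restr x I) ^ 2 = ∑ i ∈ I, x i ^ 2 := by
  simp [nrm_sq, restr, ite_pow]

theorem mem_supp {d : ℕ} {x : Fin d → ℝ} {i : Fin d} : i ∈ supp x ↔ x i ≠ 0 := by
  simp [supp]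

/-- A set whose entries all exceed a threshold `τ` outweighs any set whose other entries lie below
`τ`, up to `τ` times the difference of the cardinalities. -/
theorem sum_le_sum_add_card_sub_mul {ι : Type*} [DecidableEq ι] {a : ι → ℝ} {B C : Finset ι} {τ : ℝ}
    (hC : ∀ i ∈ C, τ ≤ a i) (hB : ∀ i ∈ B \ C, a i ≤ τ) :
    ∑ i ∈ B, a i ≤ ∑ i ∈ C, a i + ((B.card : ℝ) - C.card) * τ := by
  have h1 : ∑ i ∈ B \ C, (a i - τ) ≤ 0 :=
    Finset.sum_nonpos fun i hi => sub_nonpos.2 (hB i hi)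
  have h2 : ∑ i ∈ B ∩ C, (a i - τ) ≤ ∑ i ∈ C, (a i - τ) :=
    Finset.sum_le_sum_of_subset_of_nonneg Finset.inter_subset_right
      fun i hi _ => sub_nonneg.2 (hC i hi)
  have h3 := Finset.sum_inter_add_sum_sdiff B C fun i => a i - τ
  have h4 : ∑ i ∈ B, (a i - τ) = ∑ i ∈ B, a i - B.card * τ := by simp [Finset.sum_sub_distrib]
  have h5 : ∑ i ∈ C, (a i - τ) = ∑ i ∈ C, a i - C.card * τ := by simp [Finset.sum_sub_distrib]
  linarith

/-- The `l` largest entries outside `I` carry at least the fraction `l / k` of the energy of any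
set of at most `k` entries outside `I`. -/
theorem card_mul_sum_le_of_top {ι : Type*} [DecidableEq ι] {a : ι → ℝ} (ha : ∀ i, 0 ≤ a i)
    {L M : Finset ι} {k : ℕ} (hL : L.Nonempty) (hLk : L.card ≤ k) (hMk : M.card ≤ k)
    (htop : ∀ j ∈ L, ∀ i ∈ M \ L, a i ≤ a j) :
    (L.card : ℝ) * ∑ i ∈ M, a i ≤ k * ∑ i ∈ L, a i := by
  obtain ⟨j, hj, hmin⟩ := L.exists_min_image a hL
  have h := sum_le_sum_add_card_sub_mul hmin (htop j hj)
  have hτ : L.card * a j ≤ ∑ i ∈ L, a i := by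
    simpa using L.card_nsmul_le_sum a (a j) hmin
  have hLk' : (L.card : ℝ) ≤ k := mod_cast hLk
  have hMk' : (M.card : ℝ) ≤ k := mod_cast hMk
  have h1 : ((M.card : ℝ) - L.card) * a j ≤ (k - L.card) * a j :=
    mul_le_mul_of_nonneg_right (by linarith) (ha j)
  have h2 := mul_le_mul_of_nonneg_left hτ (sub_nonneg.2 hLk')
  have h3 := mul_le_mul_of_nonneg_left (h.trans (add_le_add_right h1 _))
    (Nat.cast_nonneg (α := ℝ) L.card)
  linarith

/-- If the selection `S` leaves out part of `L`, the entries that it finds outside `I` carry the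
energy which the target support `T` gains over `I`. -/
theorem sum_sdiff_le_sum_found {ι : Type*} [Fintype ι] [DecidableEq ι] {a : ι → ℝ}
    (ha : ∀ i, 0 ≤ a i) {I L S T : Finset ι}
    (hTI : T.card ≤ I.card) (hSI : S.card = I.card)
    (hLtop : ∀ j ∈ L, ∀ i ∈ Iᶜ \ L, a i ≤ a j)
    (hStop : ∀ j ∈ S, ∀ i ∈ (I ∪ L) \ S, a i ≤ a j) (hLS : ¬ L ⊆ S) :
    ∑ i ∈ T \ I, a i - ∑ i ∈ I \ T, a i ≤ ∑ i ∈ S \ I, a i := by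
  obtain ⟨j, hj, hmax⟩ := (L \ S).exists_max_image a (Finset.sdiff_nonempty.2 hLS)
  have hSj : ∀ i ∈ S, a j ≤ a i := fun i hi => hStop i hi j (by grind)
  have h := sum_le_sum_add_card_sub_mul (a := a) (B := T \ I) (C := S \ I) (τ := a j)
    (fun i hi => hSj i (Finset.mem_sdiff.1 hi).1) (fun i hi => by
      by_cases hiL : i ∈ L
      · exact hmax i (by grind)
      · exact hLtop j (by grind) i (by simp; grind))
  have h1 : (((I \ T) ∩ S).card : ℝ) * a j ≤ ∑ i ∈ (I \ T) ∩ S, a i := by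
    simpa using ((I \ T) ∩ S).card_nsmul_le_sum a (a j)
      fun i hi => hSj i (Finset.mem_inter.1 hi).2
  have h2 : ∑ i ∈ (I \ T) ∩ S, a i ≤ ∑ i ∈ I \ T, a i :=
    Finset.sum_le_sum_of_subset_of_nonneg Finset.inter_subset_left fun i _ _ => ha i
  have h3 : (T \ I).card ≤ ((I \ T) ∩ S).card + (S \ I).card := by
    have e1 := Finset.card_sdiff_add_card_inter (I \ T) S
    have e2 : ((I \ T) \ S).card ≤ (I \ S).card := Finset.card_le_card (by grind)
    have e3 := Finset.card_sdiff_add_card_inter I S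
    have e4 := Finset.card_sdiff_add_card_inter S I
    have e5 := Finset.card_sdiff_add_card_inter I T
    have e6 := Finset.card_sdiff_add_card_inter T I
    rw [Finset.inter_comm] at e4 e6
    omega
  have h4 : ((T \ I).card : ℝ) ≤ ((I \ T) ∩ S).card + (S \ I).card := mod_cast h3
  have h5 := mul_le_mul_of_nonneg_right h4 (ha j)
  linarith

/-- After a gradient step from a least-squares solution, the missed indices outweigh the wrongly
selected ones by a multiple of the objective. -/
theorem mul_obj_le_sum_missed_sub_sum_wrong {m n k : ℕ} {A : Matrix (Fin m) (Fin n) ℝ}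
    {w x : Fin n → ℝ} (hw : (supp w).card ≤ k) {δ : ℝ} (hRIP : RIP A (2 * k) δ) (η : ℝ)
    {I : Finset (Fin n)} (hI : I.card = k) (hx : lsSol A (A.mulVec w) I x) {z : Fin n → ℝ}
    (hz : z = fun i => x i - η * Aᵀ.mulVec (A.mulVec x - A.mulVec w) i) :
    2 * (2 * η - 1 / (1 - δ)) * obj A (A.mulVec w) x ≤
      ∑ i ∈ supp w \ I, z i ^ 2 - ∑ i ∈ I \ supp w, z i ^ 2 := by
  obtain ⟨-, hδ, hRIP⟩ := hRIP
  obtain ⟨hxI, hg⟩ := hx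
  have hx0 : ∀ i, i ∉ I → x i = 0 := fun i hi => by
    by_contra h
    exact hi (hxI (mem_supp.2 h))
  set g := Aᵀ.mulVec (A.mulVec x - A.mulVec w) with hgdef
  have hcard : (supp (x - w)).card ≤ 2 * k := by
    have hsub : supp (x - w) ⊆ I ∪ supp w := fun i hi => by
      by_contra h
      simp only [Finset.mem_union, mem_supp, not_or, not_not] at h
      exact mem_supp.1 hi (by simp [hx0 i h.1, h.2])
    have := (Finset.card_le_card hsub).trans (Finset.card_union_le _ _)
    omega
  have hlow := (hRIP (x - w) hcard).1
  have hgrad : ∑ i, g i * (x i - w i) = nrm (A.mulVec x - A.mulVec w) ^ 2 := by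
    have : g ⬝ᵥ (x - w) = (A.mulVec x - A.mulVec w) ⬝ᵥ (A.mulVec x - A.mulVec w) := by
      rw [hgdef, Matrix.mulVec_transpose, ← Matrix.dotProduct_mulVec, Matrix.mulVec_sub]
    rw [nrm_sq]
    simpa [dotProduct, ← sq] using this
  have hpt : ∀ i, 2 * η * (g i * (x i - w i)) - (x i - w i) ^ 2 ≤
      (if i ∈ supp w \ I then z i ^ 2 else 0) - (if i ∈ I \ supp w then z i ^ 2 else 0) := by
    intro i
    by_cases hi : i ∈ I
    · by_cases hwi : w i = 0
      · simp [hz, hi, hwi, hg i hi, mem_supp]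
      · simp [hi, hwi, hg i hi, mem_supp, sq_nonneg]
    · by_cases hwi : w i = 0
      · simp [hi, hwi, hx0 i hi, mem_supp]
      · simp [hz, mem_supp, hi, hwi, hx0 i hi]
        linarith [sq_nonneg (η * g i + w i)]
  have hsum := Finset.sum_le_sum fun i (_ : i ∈ Finset.univ) => hpt i
  simp only [Finset.sum_sub_distrib, ← Finset.mul_sum, hgrad, Finset.sum_ite_mem,
    Finset.univ_inter] at hsum
  rw [Matrix.mulVec_sub] at hlow
  have hu : ∑ i, (x i - w i) ^ 2 ≤ 1 / (1 - δ) * nrm (A.mulVec x - A.mulVec w) ^ 2 := by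
    rw [one_div_mul_eq_div, le_div_iff₀ (by linarith), mul_comm]
    simpa [nrm_sq] using hlow
  rw [obj]
  linarith

theorem stmt6 {m n k l : ℕ} (A : Matrix (Fin m) (Fin n) ℝ) (xstar : Fin n → ℝ)
    (hsp : (supp xstar).card ≤ k) (b : Fin m → ℝ) (hb : b = A.mulVec xstar)
    (δ : ℝ) (hRIP : RIP A (2*k) δ)
    (η : ℝ) (hη1 : 1/2 < η) (hη2 : η < 1) (hδη : δ < 1 - 1/(2*η))
    (x : Fin n → ℝ) (I : Finset (Fin n)) (hI : I.card = k) (hx : lsSol A b I x)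
    (hf : 0 < obj A b x)
    (z : Fin n → ℝ) (hz : z = fun i => x i - η * Aᵀ.mulVec (A.mulVec x - b) i)
    (hl1 : 1 ≤ l) (hlk : l ≤ k)
    (L : Finset (Fin n)) (hLsub : L ⊆ Iᶜ) (hLcard : L.card = l)
    (hLtop : ∀ j ∈ L, ∀ j' ∈ Iᶜ \ L, |z j'| ≤ |z j|)
    (S : Finset (Fin n)) (hSsub : S ⊆ I ∪ L) (hScard : S.card = k)
    (hStop : ∀ j ∈ S, ∀ j' ∈ (I ∪ L) \ S, |z j'| ≤ |z j|)
    (y : Fin n → ℝ) (hy : y = restr z S)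
    (F : Finset (Fin n)) (hF : F = S \ I)
    (c : ℝ) (hc : c = min (4*η*(1-η)^2) (2*(2*η - 1/(1-δ)))) :
    0 < c ∧ F ≠ ∅ ∧ ((l : ℝ)/(k : ℝ)) * c * obj A b x ≤ (nrm (restr y F))^2 := by
  subst hb hF hy hc
  have hk : (0 : ℝ) < k := mod_cast (by omega : 0 < k)
  have hδ1 := hRIP.2.1
  have hc1 : 0 < 4 * η * (1 - η) ^ 2 := by
    have : 0 < 1 - η := by linarith
    positivity
  have hc2 : 0 < 2 * (2 * η - 1 / (1 - δ)) := by
    have : 1 / (1 - δ) < 2 * η := by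
      rw [one_div_lt (by linarith) (by linarith)]
      linarith
    linarith
  have hc := lt_min hc1 hc2
  set c := min (4 * η * (1 - η) ^ 2) (2 * (2 * η - 1 / (1 - δ)))
  have hgain := mul_obj_le_sum_missed_sub_sum_wrong hsp hRIP η hI hx hz
  have hcgain : c * obj A (A.mulVec xstar) x ≤
      ∑ i ∈ supp xstar \ I, z i ^ 2 - ∑ i ∈ I \ supp xstar, z i ^ 2 :=
    (mul_le_mul_of_nonneg_right (min_le_right _ _) hf.le).trans hgain
  have hpos : 0 < c * obj A (A.mulVec xstar) x := mul_pos hc hf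
  have hfound : nrm (restr (restr z S) (S \ I)) ^ 2 = ∑ i ∈ S \ I, z i ^ 2 := by
    rw [nrm_restr_sq]
    exact Finset.sum_congr rfl fun i hi => by rw [restr, if_pos (Finset.mem_sdiff.1 hi).1]
  have hLtop' : ∀ j ∈ L, ∀ i ∈ Iᶜ \ L, z i ^ 2 ≤ z j ^ 2 := fun j hj i hi =>
    sq_le_sq.2 (hLtop j hj i hi)
  have hmain : (l : ℝ) / k * c * obj A (A.mulVec xstar) x ≤ ∑ i ∈ S \ I, z i ^ 2 := by
    rw [mul_assoc, div_mul_eq_mul_div, div_le_iff₀ hk, mul_comm _ (k : ℝ)]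
    by_cases hLS : L ⊆ S
    · have hSL : S \ I = L := by
        ext i
        have h1 := @hLsub i
        have h2 := @hSsub i
        have h3 := @hLS i
        simp only [Finset.mem_compl, Finset.mem_union, Finset.mem_sdiff] at *
        tauto
      have h := card_mul_sum_le_of_top (a := fun i => z i ^ 2) (fun i => sq_nonneg _)
        (M := supp xstar \ I) (Finset.card_pos.1 (by omega)) (hLcard.trans_le hlk)
        ((Finset.card_le_card Finset.sdiff_subset).trans hsp)
        (fun j hj i hi => hLtop' j hj i (by simp; grind))
      rw [hLcard] at h
      rw [hSL]
      refine le_trans (mul_le_mul_of_nonneg_left (hcgain.trans ?_) (Nat.cast_nonneg l)) h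
      exact sub_le_self _ (Finset.sum_nonneg fun i _ => sq_nonneg _)
    · have h := sum_sdiff_le_sum_found (a := fun i => z i ^ 2) (fun i => sq_nonneg _)
        (hsp.trans hI.ge) (hScard.trans hI.symm) hLtop'
        (fun j hj i hi => sq_le_sq.2 (hStop j hj i hi)) hLS
      exact mul_le_mul (mod_cast hlk) (hcgain.trans h) hpos.le hk.le
  refine ⟨hc, fun hempty => ?_, hfound ▸ hmain⟩
  rw [hempty, Finset.sum_empty, mul_assoc] at hmain
  have hl : (0 : ℝ) < l := mod_cast hl1
  exact hmain.not_gt (mul_pos (div_pos hl hk) hpos)
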